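/- arXiv:2203.02992 — 2 statements merged into one kernel-verified Lean document; each statement's English description precedes it below -/
import Mathlib

section
/- Let G be the input graph of a color-counting 1-locally checkable problem with clique-width k-expression e_G, let Γ be a set of colorings of G (the colorings satisfying the global properties), and let a ∈ Colors. Let σ ⊆ ℕ and let (Q, {1}, δ, q_0, F) be a deterministic finite-state automaton over the one-letter alphabet {1} that accepts the string of n consecutive 1's if and only if n ∈ σ. Let ∈_F : Q → {True, False} be defined by ∈_F(s) = (s ∈ F). Suppose that for some property P of parameter triples (C, N, p̂): (i) the minimum weight of a proper coloring of G lying in Γ equals min{λ(e_G, C, N, p̂) : P(C, N, p̂) = True}; (ii) for every proper coloring c of G lying in Γ there exist C, N, p̂ with P(C, N, p̂) = True such that c is a (C, N, p̂)-coloring of G; and (iii) for all C, N, p̂ with P(C, N, p̂) = True and λ(e_G, C, N, p̂) ≠ Error, every (C, N, p̂)-coloring of G is a proper coloring of G lying in Γ. Then the minimum weight of a proper coloring c of G lying in Γ and satisfying |{v ∈ V(G) : c(v) = a}| ∈ σ equals min{λ(e_G, C, N, p̂, q_0, ∈_F) : P(C, N, p̂) = True}. Moreover: (a) for every proper coloring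 c of G lying in Γ with |{v ∈ V(G) : c(v) = a}| ∈ σ there exist C, N, p̂ with P(C, N, p̂) = True such that c is a (C, N, p̂, q_0, ∈_F)-coloring of G; and (b) for all C, N, p̂ with P(C, N, p̂) = True and λ(e_G, C, N, p̂, q_0, ∈_F) ≠ Error, every (C, N, p̂, q_0, ∈_F)-coloring c of G is a proper coloring of G lying in Γ with |{v ∈ V(G) : c(v) = a}| ∈ σ. -/
open Finset
open scoped Classical

noncomputable section

/-- A vertex-labeled graph with boolean adjacency and vertex labels in `Fin k`. -/
structure LabGraph (V : Type) (k : ℕ) where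
  verts : Finset V
  adj : V → V → Bool
  lab : V → Fin k

/-- Clique-width expressions with labels in `Fin k` over vertex type `V`:
creation `node i v` of a new vertex `v` with label `i`, disjoint union `union`,
join `η_{i,j}` and relabeling `ρ_{i→j}`. -/
inductive CW (V : Type) (k : ℕ) where
  | node (i : Fin k) (v : V)
  | union (e₁ e₂ : CW V k)
  | join (i j : Fin k) (e : CW V k)
  | relabel (i j : Fin k) (e : CW V k)

variable {V : Type} [Fintype V] [DecidableEq V] {k : ℕ}

/-- The labeled graph `G_e` constructed by a clique-width expression `e`. -/
def CW.sem : CW V k → LabGraph V k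
  | .node i v => ⟨{v}, fun _ _ => false, fun _ => i⟩
  | .union e₁ e₂ =>
      ⟨e₁.sem.verts ∪ e₂.sem.verts,
       fun u w => e₁.sem.adj u w || e₂.sem.adj u w,
       fun v => if v ∈ e₁.sem.verts then e₁.sem.lab v else e₂.sem.lab v⟩
  | .join i j e =>
      ⟨e.sem.verts,
       fun u w => e.sem.adj u w ||
         (decide (u ∈ e.sem.verts) && decide (w ∈ e.sem.verts) && decide (u ≠ w) &&
          ((decide (e.sem.lab u = i) && decide (e.sem.lab w = j)) ||
           (decide (e.sem.lab u = j) && decide (e.sem.lab w = i)))),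
       e.sem.lab⟩
  | .relabel i j e =>
      ⟨e.sem.verts, e.sem.adj, fun v => if e.sem.lab v = i then j else e.sem.lab v⟩

/-- Well-formedness of a clique-width expression: disjoint unions are over disjoint
vertex sets, joins and relabelings use two distinct labels, and a relabeling
`ρ_{i→j}(e)` is only applied when `j ∉ ℓ̄(e)`, i.e. some vertex of `G_e` has label `j`. -/
def CW.wf : CW V k → Prop
  | .node _ _ => True
  | .union e₁ e₂ => e₁.wf ∧ e₂.wf ∧ Disjoint e₁.sem.verts e₂.sem.verts
  | .join i j e => i ≠ j ∧ e.wf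
  | .relabel i j e => i ≠ j ∧ (∃ v ∈ e.sem.verts, e.sem.lab v = j) ∧ e.wf

/-- Irredundancy: whenever a join `η_{i,j}` is applied, there are no already existing
edges between vertices with label `i` and vertices with label `j`. -/
def CW.irred : CW V k → Prop
  | .node _ _ => True
  | .union e₁ e₂ => e₁.irred ∧ e₂.irred
  | .join i j e => e.irred ∧
      ∀ u w, e.sem.adj u w = true → ¬(e.sem.lab u = i ∧ e.sem.lab w = j)
  | .relabel _ _ e => e.irred

/-- `CW.Sub e' e` means that `e'` is a subexpression of `e`. -/
inductive CW.Sub : CW V k → CW V k → Prop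
  | refl (e : CW V k) : CW.Sub e e
  | unionL {e e₁ : CW V k} (e₂ : CW V k) : CW.Sub e e₁ → CW.Sub e (.union e₁ e₂)
  | unionR (e₁ : CW V k) {e e₂ : CW V k} : CW.Sub e e₂ → CW.Sub e (.union e₁ e₂)
  | join (i j : Fin k) {e e' : CW V k} : CW.Sub e e' → CW.Sub e (.join i j e')
  | relabel (i j : Fin k) {e e' : CW V k} : CW.Sub e e' → CW.Sub e (.relabel i j e')

/-- The data of a color-counting 1-locally checkable problem with colors `Fin q`
on vertex type `V` and weight set `W` (with order `≤`, maximum element `err`,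
operation `op` with neutral element `neutral`, `err` absorbing, `op` monotone). -/
structure LCP (V : Type) (q : ℕ) (W : Type) [LinearOrder W] where
  /-- the maximum element `Error` -/
  err : W
  le_err : ∀ s : W, s ≤ err
  /-- the operation `⊛` -/
  op : W → W → W
  op_comm : ∀ a b, op a b = op b a
  op_assoc : ∀ a b c, op (op a b) c = op a (op b c)
  /-- the neutral element of `⊛` -/
  neutral : W
  op_neutral : ∀ a, op a neutral = a
  op_err : ∀ a, op a err = err
  op_mono : ∀ a b c, a ≤ b → op a c ≤ op b c
  /-- the set `L_v` of possible colors of each vertex -/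
  L : V → Finset (Fin q)
  L_nonempty : ∀ v, (L v).Nonempty
  /-- the weights `w_{v,a}` -/
  wt : V → Fin q → W
  wt_ne_err : ∀ v a, a ∈ L v → wt v a ≠ err
  /-- the color-counting check function -/
  check : V → Fin q → (Fin q → ℕ) → Bool

variable {W : Type} [LinearOrder W] {q : ℕ}

/-- The weight `w(c) = ⊛_{v ∈ S} w_{v,c(v)}` of a coloring on a vertex set `S`. -/
def LCP.weight (P : LCP V q W) (S : Finset V) (c : V → Fin q) : W :=
  (S.toList.map fun v => P.wt v (c v)).foldr P.op P.neutral

/-- The minimum of `f` over the finite set `S`, and `d` if `S` is empty. -/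
def finMin {α : Type} (S : Finset α) (f : α → W) (d : W) : W :=
  if h : S.Nonempty then S.inf' h f else d

/-- Matrices in `{0,...,𝓝}^{k×q}`. -/
abbrev Mat (k q 𝓝 : ℕ) := Fin k → Fin q → Fin (𝓝 + 1)

/-- `c` is a `(C,N)`-coloring of `G_e`: a valid coloring satisfying (C1) and (C2). -/
def IsCN (P : LCP V q W) (𝓝 : ℕ) (e : CW V k) (C N : Mat k q 𝓝) (c : V → Fin q) : Prop :=
  (∀ v ∈ e.sem.verts, c v ∈ P.L v) ∧
  (∀ (i : Fin k) (a : Fin q),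
    min 𝓝 (e.sem.verts.filter fun v => c v = a ∧ e.sem.lab v = i).card = (C i a : ℕ)) ∧
  (∀ v ∈ e.sem.verts,
    P.check v (c v) (fun j =>
      min 𝓝 ((N (e.sem.lab v) j : ℕ) +
        (e.sem.verts.filter fun u => e.sem.adj v u = true ∧ c u = j).card)) = true)

/-- `λ(e,C,N)`: minimum weight of a `(C,N)`-coloring of `G_e`, `Error` if none exists. -/
def lambda (P : LCP V q W) (𝓝 : ℕ) (e : CW V k) (C N : Mat k q 𝓝) : W :=
  finMin (univ.filter fun c : V → Fin q => IsCN P 𝓝 e C N c) (P.weight e.sem.verts) P.err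

/-- `c` is a proper coloring of `G_e`. -/
def IsProper (P : LCP V q W) (e : CW V k) (c : V → Fin q) : Prop :=
  (∀ v ∈ e.sem.verts, c v ∈ P.L v) ∧
  (∀ v ∈ e.sem.verts,
    P.check v (c v)
      (fun j => (e.sem.verts.filter fun u => e.sem.adj v u = true ∧ c u = j).card) = true)

variable {Pt Q : Type}

/-- `λ(e,C,N,p̂)` for an abstract family `Col` of `(C,N,p̂)`-colorings of the graphs `G_e`:
the minimum weight of a `(C,N,p̂)`-coloring of `G_e`, `Error` if none exists. -/
def lambdaA (P : LCP V q W) {𝓝 : ℕ}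
    (Col : CW V k → Mat k q 𝓝 → Mat k q 𝓝 → Pt → (V → Fin q) → Prop)
    (e : CW V k) (C N : Mat k q 𝓝) (p : Pt) : W :=
  finMin (univ.filter fun c : V → Fin q => Col e C N p c) (P.weight e.sem.verts) P.err

/-- `c` is a `(C,N,p̂,s_a,f_a)`-coloring of `G_e`: a `(C,N,p̂)`-coloring of `G_e` such that
`f_a (δ^n (s_a)) = true`, where `n = |{v ∈ V(G_e) : c v = a}|` and `δ` is the transition
function of a deterministic finite-state automaton over the one-letter alphabet `{1}`. -/
def ColS {𝓝 : ℕ}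
    (Col : CW V k → Mat k q 𝓝 → Mat k q 𝓝 → Pt → (V → Fin q) → Prop)
    (δ : Q → Q) (a : Fin q) (e : CW V k) (C N : Mat k q 𝓝) (p : Pt)
    (s : Q) (f : Q → Bool) (c : V → Fin q) : Prop :=
  Col e C N p c ∧ f (δ^[(e.sem.verts.filter fun v => c v = a).card] s) = true

/-- `λ(e,C,N,p̂,s_a,f_a)`: minimum weight of a `(C,N,p̂,s_a,f_a)`-coloring of `G_e`,
`Error` if none exists. -/
def lambdaS (P : LCP V q W) {𝓝 : ℕ}
    (Col : CW V k → Mat k q 𝓝 → Mat k q 𝓝 → Pt → (V → Fin q) → Prop)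
    (δ : Q → Q) (a : Fin q) (e : CW V k) (C N : Mat k q 𝓝) (p : Pt)
    (s : Q) (f : Q → Bool) : W :=
  finMin (univ.filter fun c : V → Fin q => ColS Col δ a e C N p s f c)
    (P.weight e.sem.verts) P.err

/-- The coloring `c₁ ∪ c₂` agreeing with `c₁` on `S` and with `c₂` elsewhere. -/
def glueOn (S : Finset V) (c₁ c₂ : V → Fin q) : V → Fin q :=
  fun v => if v ∈ S then c₁ v else c₂ v

theorem finMin_le_aux {α : Type} (S : Finset α) (f : α → W) (d : W) (x : α) (hx : x ∈ S) :
    finMin S f d ≤ f x := by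
  unfold finMin
  rw [dif_pos ⟨x, hx⟩]
  exact Finset.inf'_le f hx

theorem le_finMin_aux {α : Type} (S : Finset α) (f : α → W) (d w : W) (hd : w ≤ d)
    (h : ∀ x ∈ S, w ≤ f x) : w ≤ finMin S f d := by
  unfold finMin
  split_ifs with hS
  · exact Finset.le_inf' hS f h
  · exact hd

/-- Incorporating the global size constraint for color `a` via a one-letter
DFA `(Q, δ, q₀, F)` accepting `n` consecutive 1's iff `n ∈ σ`: if the minimum weight of a
proper coloring of `G` lying in `Γ` equals `min{λ(e_G,C,N,p̂) : P(C,N,p̂)}` (with the two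
coherence conditions (ii),(iii)), then the minimum weight of a proper coloring of `G` lying
in `Γ` whose color class of `a` has size in `σ` equals
`min{λ(e_G,C,N,p̂,q₀,∈_F) : P(C,N,p̂)}`, and (a),(b) hold. -/
theorem statement6 [Fintype Pt] [Fintype Q]
    (P : LCP V q W) (𝓝 : ℕ)
    (Col : CW V k → Mat k q 𝓝 → Mat k q 𝓝 → Pt → (V → Fin q) → Prop)
    (hvalid : ∀ (e : CW V k) (C N : Mat k q 𝓝) (p : Pt) (c : V → Fin q),
      Col e C N p c → ∀ v ∈ e.sem.verts, c v ∈ P.L v)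
    (eG : CW V k) (hwf : eG.wf)
    (Γ : Set (V → Fin q)) (a : Fin q) (σ : Set ℕ)
    (δ : Q → Q) (q0 : Q) (Fs : Q → Bool)
    (hacc : ∀ n : ℕ, Fs (δ^[n] q0) = true ↔ n ∈ σ)
    (Pred : Mat k q 𝓝 → Mat k q 𝓝 → Pt → Prop)
    (h1 : finMin (univ.filter fun c : V → Fin q => IsProper P eG c ∧ c ∈ Γ)
            (P.weight eG.sem.verts) P.err =
          finMin (univ.filter fun x : Mat k q 𝓝 × Mat k q 𝓝 × Pt => Pred x.1 x.2.1 x.2.2)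
            (fun x => lambdaA P Col eG x.1 x.2.1 x.2.2) P.err)
    (h2 : ∀ c : V → Fin q, IsProper P eG c → c ∈ Γ →
      ∃ C N p, Pred C N p ∧ Col eG C N p c)
    (h3 : ∀ (C N : Mat k q 𝓝) (p : Pt), Pred C N p →
      lambdaA P Col eG C N p ≠ P.err →
      ∀ c : V → Fin q, Col eG C N p c → IsProper P eG c ∧ c ∈ Γ) :
    (finMin (univ.filter fun c : V → Fin q => IsProper P eG c ∧ c ∈ Γ ∧
          (eG.sem.verts.filter fun v => c v = a).card ∈ σ)
        (P.weight eG.sem.verts) P.err =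
      finMin (univ.filter fun x : Mat k q 𝓝 × Mat k q 𝓝 × Pt => Pred x.1 x.2.1 x.2.2)
        (fun x => lambdaS P Col δ a eG x.1 x.2.1 x.2.2 q0 Fs) P.err) ∧
    (∀ c : V → Fin q, IsProper P eG c → c ∈ Γ →
      (eG.sem.verts.filter fun v => c v = a).card ∈ σ →
      ∃ C N p, Pred C N p ∧ ColS Col δ a eG C N p q0 Fs c) ∧
    (∀ (C N : Mat k q 𝓝) (p : Pt), Pred C N p →
      lambdaS P Col δ a eG C N p q0 Fs ≠ P.err →
      ∀ c : V → Fin q, ColS Col δ a eG C N p q0 Fs c →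
        IsProper P eG c ∧ c ∈ Γ ∧ (eG.sem.verts.filter fun v => c v = a).card ∈ σ) := by
  have hA : ∀ c : V → Fin q, IsProper P eG c → c ∈ Γ →
      (eG.sem.verts.filter fun v => c v = a).card ∈ σ →
      ∃ C N p, Pred C N p ∧ ColS Col δ a eG C N p q0 Fs c := by
    intro c hc hΓ hσ
    obtain ⟨C, N, p, hP, hcol⟩ := h2 c hc hΓ
    exact ⟨C, N, p, hP, hcol, (hacc _).2 hσ⟩
  have hB : ∀ (C N : Mat k q 𝓝) (p : Pt), Pred C N p →
      lambdaS P Col δ a eG C N p q0 Fs ≠ P.err →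
      ∀ c : V → Fin q, ColS Col δ a eG C N p q0 Fs c →
        IsProper P eG c ∧ c ∈ Γ ∧ (eG.sem.verts.filter fun v => c v = a).card ∈ σ := by
    intro C N p hP hne c hc
    have hle : lambdaA P Col eG C N p ≤ lambdaS P Col δ a eG C N p q0 Fs := by
      refine le_finMin_aux _ _ _ _ (P.le_err _) fun x hx => ?_
      refine finMin_le_aux _ _ _ x ?_
      rw [Finset.mem_filter] at hx ⊢
      exact ⟨hx.1, hx.2.1⟩
    have hne' : lambdaA P Col eG C N p ≠ P.err := fun h =>
      hne (le_antisymm (P.le_err _) (h ▸ hle))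
    obtain ⟨h4, h5⟩ := h3 C N p hP hne' c hc.1
    exact ⟨h4, h5, (hacc _).1 hc.2⟩
  refine ⟨le_antisymm ?_ ?_, hA, hB⟩
  · refine le_finMin_aux _ _ _ _ (P.le_err _) fun x hx => ?_
    rw [Finset.mem_filter] at hx
    by_cases hne : lambdaS P Col δ a eG x.1 x.2.1 x.2.2 q0 Fs = P.err
    · rw [hne]
      exact P.le_err _
    · refine le_finMin_aux _ _ _ _ (P.le_err _) fun c hc => ?_
      rw [Finset.mem_filter] at hc
      refine finMin_le_aux _ _ _ c ?_
      rw [Finset.mem_filter]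
      exact ⟨hc.1, hB _ _ _ hx.2 hne c hc.2⟩
  · refine le_finMin_aux _ _ _ _ (P.le_err _) fun c hc => ?_
    rw [Finset.mem_filter] at hc
    obtain ⟨C, N, p, hP, hcol⟩ := hA c hc.2.1 hc.2.2.1 hc.2.2.2
    refine le_trans (finMin_le_aux _ _ _ (C, N, p) ?_) (finMin_le_aux _ _ _ c ?_)
    · rw [Finset.mem_filter]
      exact ⟨Finset.mem_univ _, hP⟩
    · rw [Finset.mem_filter]
      exact ⟨Finset.mem_univ _, hcol⟩
end
end

section
/- Let e_1 ⊕ e_2 be a subexpression of e_G, let C, N ∈ {0,...,𝒩}^{k×q}, let p̂ be a tuple of additional parameters, and let a ∈ Colors, s_a ∈ Q, f_a : Q → {True, False}. Suppose that for some property P: (i) λ(e_1 ⊕ e_2, C, N, p̂) = min{λ(e_1, C_1, N_1, p̂_1) ⊛ λ(e_2, C_2, N_2, p̂_2) : P(C, N, p̂, C_1, N_1, p̂_1, C_2, N_2, p̂_2) = True}; (ii) for every (C,N,p̂)-coloring c of G_{e_1⊕e_2} there exist C_1, N_1, p̂_1, C_2, N_2, p̂_2 with P(C, N, p̂, C_1,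 N_1, p̂_1, C_2, N_2, p̂_2) = True such that the restriction of c to V(G_{e_1}) is a (C_1,N_1,p̂_1)-coloring of G_{e_1} and the restriction of c to V(G_{e_2}) is a (C_2,N_2,p̂_2)-coloring of G_{e_2}; and (iii) for all C_1, N_1, p̂_1, C_2, N_2, p̂_2 with P(C, N, p̂, C_1, N_1, p̂_1, C_2, N_2, p̂_2) = True, if c_1 is a (C_1,N_1,p̂_1)-coloring of G_{e_1} and c_2 is a (C_2,N_2,p̂_2)-coloring of G_{e_2}, then c_1 ∪ c_2 is a (C,N,p̂)-coloring of G_{e_1⊕e_2}. Then λ(e_1 ⊕ e_2, C, N, p̂, s_a, f_a) = min{λ(e_1, C_1, N_1, p̂_1, s_a, eq_q) ⊛ λ(e_2, C_2, N_2, p̂_2, q, f_a) : q ∈ Q and P(C, N, p̂, C_1, N_1, p̂_1, C_2, N_2, p̂_2) = True}. Moreover: (a) for every (C,N,p̂,s_a,f_a)-coloring c of G_{e_1⊕e_2} there exist q ∈ Q and C_1, N_1, p̂_1, C_2, N_2, p̂_2 with P(...) = True such that the restriction of c to V(G_{e_1}) is a (C_1,N_1,p̂_1,s_a,eq_q)-coloring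 of G_{e_1} and the restriction of c to V(G_{e_2}) is a (C_2,N_2,p̂_2,q,f_a)-coloring of G_{e_2}; and (b) for all q ∈ Q and C_1, N_1, p̂_1, C_2, N_2, p̂_2 with P(...) = True, if c_1 is a (C_1,N_1,p̂_1,s_a,eq_q)-coloring of G_{e_1} and c_2 is a (C_2,N_2,p̂_2,q,f_a)-coloring of G_{e_2}, then c_1 ∪ c_2 is a (C,N,p̂,s_a,f_a)-coloring of G_{e_1⊕e_2}. -/
open Finset
open scoped Classical

noncomputable section

variable {V : Type} [Fintype V] [DecidableEq V] {k : ℕ}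

variable {W : Type} [LinearOrder W] {q : ℕ}

variable {Pt Q : Type}

theorem finMin_le {α : Type} (S : Finset α) (g : α → W) (d : W) {x : α} (hx : x ∈ S) :
    finMin S g d ≤ g x := by
  unfold finMin
  rw [dif_pos ⟨x, hx⟩]
  exact Finset.inf'_le _ hx

theorem le_finMin {α : Type} (S : Finset α) (g : α → W) (d b : W) (hd : b ≤ d)
    (h : ∀ x ∈ S, b ≤ g x) : b ≤ finMin S g d := by
  unfold finMin
  split_ifs with hS
  · exact Finset.le_inf' _ _ h
  · exact hd

theorem finMin_cases {α : Type} (S : Finset α) (g : α → W) (d : W) :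
    finMin S g d = d ∨ ∃ x ∈ S, finMin S g d = g x := by
  unfold finMin
  split_ifs with hS
  · right
    exact Finset.exists_mem_eq_inf' hS g
  · left; rfl

theorem LCP.foldr_append (P : LCP V q W) (l₁ l₂ : List W) :
    (l₁ ++ l₂).foldr P.op P.neutral =
      P.op (l₁.foldr P.op P.neutral) (l₂.foldr P.op P.neutral) := by
  induction l₁ with
  | nil => simp [P.op_comm P.neutral, P.op_neutral]
  | cons x l ih => simp only [List.cons_append, List.foldr_cons, ih, P.op_assoc]

theorem LCP.weight_union (P : LCP V q W) (S T : Finset V) (h : Disjoint S T)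
    (c : V → Fin q) : P.weight (S ∪ T) c = P.op (P.weight S c) (P.weight T c) := by
  unfold LCP.weight
  rw [← P.foldr_append, ← List.map_append]
  have hp : (S ∪ T).toList.Perm (S.toList ++ T.toList) := by
    rw [List.perm_ext_iff_of_nodup (Finset.nodup_toList _)]
    · intro v; simp
    · rw [List.nodup_append]
      refine ⟨Finset.nodup_toList _, Finset.nodup_toList _, ?_⟩
      intro x hx y hy hxy
      subst hxy
      exact Finset.disjoint_left.mp h (by simpa using hx) (by simpa using hy)
  haveI : LeftCommutative P.op :=
    ⟨fun a b c => by rw [← P.op_assoc, P.op_comm a b, P.op_assoc]⟩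
  exact (hp.map _).foldr_eq _

theorem LCP.weight_congr (P : LCP V q W) (S : Finset V) (c c' : V → Fin q)
    (h : ∀ v ∈ S, c v = c' v) : P.weight S c = P.weight S c' := by
  unfold LCP.weight
  congr 1
  apply List.map_congr_left
  intro v hv
  rw [h v (by simpa using hv)]

theorem card_union_color (S T : Finset V) (h : Disjoint S T) (c : V → Fin q) (a : Fin q) :
    ((S ∪ T).filter fun v => c v = a).card =
      (T.filter fun v => c v = a).card + (S.filter fun v => c v = a).card := by
  rw [Finset.filter_union, Finset.card_union_of_disjoint, add_comm]
  exact Finset.disjoint_filter_filter h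

theorem card_color_congr (S : Finset V) (c c' : V → Fin q) (a : Fin q)
    (h : ∀ v ∈ S, c v = c' v) :
    (S.filter fun v => c v = a).card = (S.filter fun v => c' v = a).card := by
  congr 1
  apply Finset.filter_congr
  intro v hv
  rw [h v hv]

theorem glueOn_left (S : Finset V) (c₁ c₂ : V → Fin q) :
    ∀ v ∈ S, glueOn S c₁ c₂ v = c₁ v := by
  intro v hv
  simp [glueOn, hv]

theorem glueOn_right (S T : Finset V) (h : Disjoint S T) (c₁ c₂ : V → Fin q) :
    ∀ v ∈ T, glueOn S c₁ c₂ v = c₂ v := by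
  intro v hv
  simp [glueOn, Finset.disjoint_right.mp h hv]

theorem sem_union_verts (e₁ e₂ : CW V k) :
    (CW.union e₁ e₂).sem.verts = e₁.sem.verts ∪ e₂.sem.verts := by
  rw [CW.sem]

set_option synthInstance.maxHeartbeats 1000000 in
/-- disjoint union `e₁ ⊕ e₂`, with a size parameter. Under the recurrence
assumption (i) and the coherence assumptions (ii),(iii) for the `(C,N,p̂)`-colorings,
`λ(e₁ ⊕ e₂, C, N, p̂, s_a, f_a)` equals the minimum of
`λ(e₁,C₁,N₁,p̂₁,s_a,eq_q) ⊛ λ(e₂,C₂,N₂,p̂₂,q,f_a)` over `q ∈ Q` and parameters with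
`P(C,N,p̂,C₁,N₁,p̂₁,C₂,N₂,p̂₂)`, and the coherence statements (a),(b) hold. -/
theorem statement8 [Fintype Pt] [Fintype Q] [DecidableEq Q]
    (P : LCP V q W) (𝓝 : ℕ)
    (Col : CW V k → Mat k q 𝓝 → Mat k q 𝓝 → Pt → (V → Fin q) → Prop)
    (hvalid : ∀ (e : CW V k) (C N : Mat k q 𝓝) (p : Pt) (c : V → Fin q),
      Col e C N p c → ∀ v ∈ e.sem.verts, c v ∈ P.L v)
    (hrestr : ∀ (e : CW V k) (C N : Mat k q 𝓝) (p : Pt) (c c' : V → Fin q),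
      (∀ v ∈ e.sem.verts, c v = c' v) → Col e C N p c → Col e C N p c')
    (eG e₁ e₂ : CW V k) (hsub : CW.Sub (.union e₁ e₂) eG)
    (hdisj : Disjoint e₁.sem.verts e₂.sem.verts)
    (C N : Mat k q 𝓝) (p : Pt)
    (δ : Q → Q) (a : Fin q) (s : Q) (f : Q → Bool)
    (Pred : Mat k q 𝓝 → Mat k q 𝓝 → Pt → Mat k q 𝓝 → Mat k q 𝓝 → Pt →
            Mat k q 𝓝 → Mat k q 𝓝 → Pt → Prop)
    (h1 : lambdaA P Col (.union e₁ e₂) C N p =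
      finMin (univ.filter
          fun x : (Mat k q 𝓝 × Mat k q 𝓝 × Pt) × (Mat k q 𝓝 × Mat k q 𝓝 × Pt) =>
            Pred C N p x.1.1 x.1.2.1 x.1.2.2 x.2.1 x.2.2.1 x.2.2.2)
        (fun x => P.op (lambdaA P Col e₁ x.1.1 x.1.2.1 x.1.2.2)
                       (lambdaA P Col e₂ x.2.1 x.2.2.1 x.2.2.2)) P.err)
    (h2 : ∀ c : V → Fin q, Col (.union e₁ e₂) C N p c →
      ∃ C₁ N₁ p₁ C₂ N₂ p₂, Pred C N p C₁ N₁ p₁ C₂ N₂ p₂ ∧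
        Col e₁ C₁ N₁ p₁ c ∧ Col e₂ C₂ N₂ p₂ c)
    (h3 : ∀ (C₁ N₁ : Mat k q 𝓝) (p₁ : Pt) (C₂ N₂ : Mat k q 𝓝) (p₂ : Pt),
      Pred C N p C₁ N₁ p₁ C₂ N₂ p₂ →
      ∀ c₁ c₂ : V → Fin q, Col e₁ C₁ N₁ p₁ c₁ → Col e₂ C₂ N₂ p₂ c₂ →
        Col (.union e₁ e₂) C N p (glueOn e₁.sem.verts c₁ c₂)) :
    (lambdaS P Col δ a (.union e₁ e₂) C N p s f =
      finMin (univ.filter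
          fun x : Q × (Mat k q 𝓝 × Mat k q 𝓝 × Pt) × (Mat k q 𝓝 × Mat k q 𝓝 × Pt) =>
            Pred C N p x.2.1.1 x.2.1.2.1 x.2.1.2.2 x.2.2.1 x.2.2.2.1 x.2.2.2.2)
        (fun x => P.op
          (lambdaS P Col δ a e₁ x.2.1.1 x.2.1.2.1 x.2.1.2.2 s (fun t => decide (t = x.1)))
          (lambdaS P Col δ a e₂ x.2.2.1 x.2.2.2.1 x.2.2.2.2 x.1 f)) P.err) ∧
    (∀ c : V → Fin q, ColS Col δ a (.union e₁ e₂) C N p s f c →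
      ∃ (q' : Q) (C₁ N₁ : Mat k q 𝓝) (p₁ : Pt) (C₂ N₂ : Mat k q 𝓝) (p₂ : Pt),
        Pred C N p C₁ N₁ p₁ C₂ N₂ p₂ ∧
        ColS Col δ a e₁ C₁ N₁ p₁ s (fun t => decide (t = q')) c ∧
        ColS Col δ a e₂ C₂ N₂ p₂ q' f c) ∧
    (∀ (q' : Q) (C₁ N₁ : Mat k q 𝓝) (p₁ : Pt) (C₂ N₂ : Mat k q 𝓝) (p₂ : Pt),
      Pred C N p C₁ N₁ p₁ C₂ N₂ p₂ →
      ∀ c₁ c₂ : V → Fin q,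
        ColS Col δ a e₁ C₁ N₁ p₁ s (fun t => decide (t = q')) c₁ →
        ColS Col δ a e₂ C₂ N₂ p₂ q' f c₂ →
        ColS Col δ a (.union e₁ e₂) C N p s f (glueOn e₁.sem.verts c₁ c₂)) := by
  have hA : ∀ c : V → Fin q, ColS Col δ a (.union e₁ e₂) C N p s f c →
      ∃ (q' : Q) (C₁ N₁ : Mat k q 𝓝) (p₁ : Pt) (C₂ N₂ : Mat k q 𝓝) (p₂ : Pt),
        Pred C N p C₁ N₁ p₁ C₂ N₂ p₂ ∧
        ColS Col δ a e₁ C₁ N₁ p₁ s (fun t => decide (t = q')) c ∧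
        ColS Col δ a e₂ C₂ N₂ p₂ q' f c := by
    rintro c ⟨hc, hf⟩
    obtain ⟨C₁, N₁, p₁, C₂, N₂, p₂, hP, hc1, hc2⟩ := h2 c hc
    refine ⟨_, C₁, N₁, p₁, C₂, N₂, p₂, hP, ⟨hc1, decide_eq_true rfl⟩, hc2, ?_⟩
    rw [← Function.iterate_add_apply, ← card_union_color _ _ hdisj, ← sem_union_verts]
    exact hf
  have hB : ∀ (q' : Q) (C₁ N₁ : Mat k q 𝓝) (p₁ : Pt) (C₂ N₂ : Mat k q 𝓝) (p₂ : Pt),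
      Pred C N p C₁ N₁ p₁ C₂ N₂ p₂ →
      ∀ c₁ c₂ : V → Fin q,
        ColS Col δ a e₁ C₁ N₁ p₁ s (fun t => decide (t = q')) c₁ →
        ColS Col δ a e₂ C₂ N₂ p₂ q' f c₂ →
        ColS Col δ a (.union e₁ e₂) C N p s f (glueOn e₁.sem.verts c₁ c₂) := by
    rintro q' C₁ N₁ p₁ C₂ N₂ p₂ hP c₁ c₂ ⟨hc1, hq⟩ ⟨hc2, hf⟩
    refine ⟨h3 _ _ _ _ _ _ hP _ _ hc1 hc2, ?_⟩
    rw [sem_union_verts, card_union_color _ _ hdisj, Function.iterate_add_apply,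
      card_color_congr _ _ _ a (glueOn_left e₁.sem.verts c₁ c₂),
      card_color_congr _ _ _ a (glueOn_right _ _ hdisj c₁ c₂), of_decide_eq_true hq]
    exact hf
  have hmono : ∀ x x' y y', x ≤ x' → y ≤ y' → P.op x y ≤ P.op x' y' := by
    intro x x' y y' hx hy
    refine (P.op_mono _ _ y hx).trans ?_
    rw [P.op_comm x' y, P.op_comm x' y']
    exact P.op_mono _ _ _ hy
  refine ⟨le_antisymm ?_ ?_, hA, hB⟩
  · refine le_finMin _ _ _ _ (P.le_err _) ?_
    rintro ⟨q', ⟨C₁, N₁, p₁⟩, C₂, N₂, p₂⟩ hx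
    have hP : Pred C N p C₁ N₁ p₁ C₂ N₂ p₂ := (Finset.mem_filter.mp hx).2
    show _ ≤ P.op (lambdaS P Col δ a e₁ C₁ N₁ p₁ s (fun t => decide (t = q')))
      (lambdaS P Col δ a e₂ C₂ N₂ p₂ q' f)
    rcases finMin_cases (univ.filter fun c : V → Fin q =>
        ColS Col δ a e₁ C₁ N₁ p₁ s (fun t => decide (t = q')) c)
        (P.weight e₁.sem.verts) P.err with h | ⟨c₁, hc1, h⟩
    · rw [lambdaS.eq_1 P Col δ a e₁, h, P.op_comm, P.op_err]
      exact P.le_err _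
    rcases finMin_cases (univ.filter fun c : V → Fin q =>
        ColS Col δ a e₂ C₂ N₂ p₂ q' f c)
        (P.weight e₂.sem.verts) P.err with h' | ⟨c₂, hc2, h'⟩
    · rw [lambdaS.eq_1 P Col δ a e₂, h', P.op_err]
      exact P.le_err _
    rw [lambdaS.eq_1 P Col δ a e₁, h, lambdaS.eq_1 P Col δ a e₂, h']
    have hg := hB q' C₁ N₁ p₁ C₂ N₂ p₂ hP c₁ c₂ (Finset.mem_filter.mp hc1).2
      (Finset.mem_filter.mp hc2).2
    rw [← P.weight_congr _ _ _ (glueOn_left e₁.sem.verts c₁ c₂),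
      ← P.weight_congr _ _ _ (glueOn_right _ _ hdisj c₁ c₂),
      ← P.weight_union _ _ hdisj, ← sem_union_verts]
    exact finMin_le _ _ _ (Finset.mem_filter.mpr ⟨Finset.mem_univ _, hg⟩)
  · refine le_finMin _ _ _ _ (P.le_err _) ?_
    intro c hc
    obtain ⟨q', C₁, N₁, p₁, C₂, N₂, p₂, hP, hc1, hc2⟩ := hA c (Finset.mem_filter.mp hc).2
    refine (finMin_le _ _ _ (x := (q', (C₁, N₁, p₁), (C₂, N₂, p₂)))
      (Finset.mem_filter.mpr ⟨Finset.mem_univ _, hP⟩)).trans ?_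
    rw [sem_union_verts, P.weight_union _ _ hdisj]
    exact hmono _ _ _ _
      (finMin_le _ _ _ (Finset.mem_filter.mpr ⟨Finset.mem_univ _, hc1⟩))
      (finMin_le _ _ _ (Finset.mem_filter.mpr ⟨Finset.mem_univ _, hc2⟩))
end
end
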